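/- For nonzero complex numbers r, s with s ≠ ±i q^n for all integers n, the operators on the space with basis {|m⟩ : m ∈ Z} defined by R(I)|m⟩ = i((sq^m - s^{-1}q^{-m})/(q-q^{-1}))|m⟩, R(T2)|m⟩ = (r/(sq^m + s^{-1}q^{-m}))(|m+1⟩+|m-1⟩), R(T1)|m⟩ = (i q^{1/2} r/(sq^m + s^{-1}q^{-m}))(sq^m|m+1⟩ - s^{-1}q^{-m}|m-1⟩) satisfy the defining relations of U_q(iso_2), hence define a representation R_{rs} of U_q(iso_2). -/

import Mathlib

noncomputable section

/-- The basis vector |m⟩, m ∈ ℤ. -/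
def e (m : ℤ) : ℤ →₀ ℂ := Finsupp.single m 1

/-- A linear operator on the space with basis {|m⟩ : m ∈ ℤ}, given by its values on
the basis vectors. -/
def op (f : ℤ → (ℤ →₀ ℂ)) : (ℤ →₀ ℂ) →ₗ[ℂ] (ℤ →₀ ℂ) :=
  Finsupp.lift _ _ _ f

variable (q sq r s : ℂ)

/-- R(I)|m⟩ = i((sqᵐ - s⁻¹q⁻ᵐ)/(q-q⁻¹))|m⟩. -/
def RI : (ℤ →₀ ℂ) →ₗ[ℂ] (ℤ →₀ ℂ) :=
  op fun m => (Complex.I * (s * q ^ m - s⁻¹ * q ^ (-m)) / (q - q⁻¹)) • e m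

/-- R(T2)|m⟩ = (r/(sqᵐ + s⁻¹q⁻ᵐ))(|m+1⟩ + |m-1⟩). -/
def RT2 : (ℤ →₀ ℂ) →ₗ[ℂ] (ℤ →₀ ℂ) :=
  op fun m => (r / (s * q ^ m + s⁻¹ * q ^ (-m))) • (e (m + 1) + e (m - 1))

/-- R(T1)|m⟩ = (i q^{1/2} r/(sqᵐ + s⁻¹q⁻ᵐ))(sqᵐ|m+1⟩ - s⁻¹q⁻ᵐ|m-1⟩),
where sq = q^{1/2}. -/
def RT1 : (ℤ →₀ ℂ) →ₗ[ℂ] (ℤ →₀ ℂ) :=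
  op fun m => (Complex.I * sq * r / (s * q ^ m + s⁻¹ * q ^ (-m))) •
    ((s * q ^ m) • e (m + 1) - (s⁻¹ * q ^ (-m)) • e (m - 1))

end


theorem op_e (f : ℤ → (ℤ →₀ ℂ)) (m : ℤ) : op f (e m) = f m := by
  simp [op, e]

theorem ext_e {f g : (ℤ →₀ ℂ) →ₗ[ℂ] (ℤ →₀ ℂ)} (h : ∀ m, f (e m) = g (e m)) : f = g := by
  apply Finsupp.lhom_ext'
  intro m
  ext1
  exact h m

theorem den_ne (q s : ℂ) (hq : q ≠ 0) (hs : s ≠ 0)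
    (hsi : ∀ n : ℤ, s ≠ Complex.I * q ^ n ∧ s ≠ -(Complex.I * q ^ n)) (m : ℤ) :
    (s * q ^ m) ^ 2 + 1 ≠ 0 := by
  intro h
  have hm : q ^ m ≠ 0 := zpow_ne_zero _ hq
  have h2 : (s * q ^ m - Complex.I) * (s * q ^ m + Complex.I) = 0 := by
    linear_combination h - Complex.I_sq
  rcases mul_eq_zero.1 h2 with h3 | h3
  · apply (hsi (-m)).1
    rw [zpow_neg]
    field_simp
    linear_combination h3
  · apply (hsi (-m)).2
    rw [zpow_neg]
    field_simp
    linear_combination h3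

/-- For q not 0, ±1 and not a root of unity, and nonzero r, s with
s ≠ ±i qⁿ for all n ∈ ℤ, the operators R(I), R(T2), R(T1) satisfy the defining
relations of U_q(iso₂), hence define a representation R_{rs}. -/
theorem stmt6 (q sq r s : ℂ) (hq : q ≠ 0) (hsq : sq ^ 2 = q)
    (hroot : ∀ n : ℕ, n ≠ 0 → q ^ n ≠ 1)
    (hr : r ≠ 0) (hs : s ≠ 0)
    (hsi : ∀ n : ℤ, s ≠ Complex.I * q ^ n ∧ s ≠ -(Complex.I * q ^ n)) :
    sq • (RI q s ∘ₗ RT2 q r s) - sq⁻¹ • (RT2 q r s ∘ₗ RI q s) = RT1 q sq r s ∧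
    sq • (RT1 q sq r s ∘ₗ RI q s) - sq⁻¹ • (RI q s ∘ₗ RT1 q sq r s) = RT2 q r s ∧
    sq • (RT2 q r s ∘ₗ RT1 q sq r s) - sq⁻¹ • (RT1 q sq r s ∘ₗ RT2 q r s) = 0 := by
  have hp : sq ≠ 0 := by rintro rfl; apply hq; rw [← hsq]; norm_num
  have hd := den_ne q s hq hs hsi
  have hq2 : q ^ 2 - 1 ≠ 0 := sub_ne_zero.2 (hroot 2 (by norm_num))
  have hI := Complex.I_sq
  subst hsq
  refine ⟨ext_e fun m => ?_, ext_e fun m => ?_, ext_e fun m => ?_⟩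
  all_goals
    have h0 := hd m
    have hP := hd (m + 1)
    have hM := hd (m - 1)
    have hm : (sq ^ 2) ^ m ≠ 0 := zpow_ne_zero _ hq
    have eP : m + 1 - 1 = m := by ring
    have eM : m - 1 + 1 = m := by ring
    simp only [RI, RT1, RT2, LinearMap.sub_apply, LinearMap.smul_apply, LinearMap.comp_apply,
      op_e, map_add, map_sub, map_smul, LinearMap.zero_apply, eP, eM, neg_add, neg_sub,
      zpow_add₀ hq, zpow_sub₀ hq, zpow_neg, zpow_one] at *
    generalize (sq ^ 2) ^ m = y at *
    obtain ⟨x, rfl⟩ : ∃ x, y = x / s := ⟨y * s, by field_simp⟩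
    have hx : x ≠ 0 := by rintro rfl; simp at hm
    have d0 : x ^ 2 + 1 ≠ 0 := by intro h; apply h0; field_simp; exact h
    have dP : x ^ 2 * sq ^ 4 + 1 ≠ 0 := by
      intro h; apply hP; field_simp; linear_combination h
    have dM : x ^ 2 + sq ^ 4 ≠ 0 := by
      intro h; apply hM; field_simp; linear_combination h
    have dq : sq ^ 4 - 1 ≠ 0 := by intro h; apply hq2; linear_combination h
    clear h0 hP hM hq2 hsi hroot hd
    have E0 : s * (x / s) + s⁻¹ * (x / s)⁻¹ = (x ^ 2 + 1) / x := by field_simp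
    have EQ : sq ^ 2 - (sq ^ 2)⁻¹ = (sq ^ 4 - 1) / sq ^ 2 := by field_simp
    have EP : s * (x / s * sq ^ 2) + s⁻¹ * ((x / s)⁻¹ * (sq ^ 2)⁻¹) =
      (x ^ 2 * sq ^ 4 + 1) / (x * sq ^ 2) := by field_simp
    have EM : s * (x / s / sq ^ 2) + s⁻¹ * (x / s / sq ^ 2)⁻¹ =
      (x ^ 2 + sq ^ 4) / (x * sq ^ 2) := by field_simp
    try simp only [mul_inv] at *
    try simp only [E0, EQ, EP, EM]
    match_scalars
  all_goals field_simp
  all_goals try ring_nf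
  all_goals try simp only [hI]
  all_goals try ring
  have dP' : 1 + x ^ 2 * sq ^ 4 ≠ 0 := by rw [add_comm]; exact dP
  field_simp
  ring
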